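/- (Covariant Hamilton equation for sine-Gordon.) Let m, β ∈ ℝ with β ≠ 0 and let φ : ℝ² → ℝ (coordinates (x,t)) be twice continuously differentiable. Define U(x,t;λ) = U(φ(x,t), ∂_tφ(x,t); λ) and V(x,t;λ) = V(φ(x,t), ∂_xφ(x,t); λ). Then the covariant Hamilton equation ∂_x V(x,t;λ) − ∂_t U(x,t;λ) = (iβ/2)(k₀(λ)∂_tφ − k₁(λ)∂_xφ) cos(βφ/2) σ₁ + (iβ/2)(k₀(λ)∂_xφ − k₁(λ)∂_tφ) sin(βφ/2) σ₂ − i(m²/4) sin(βφ) σ₃ holds for all (x,t) ∈ ℝ² and all λ ∈ ℂ with λ ≠ 0 if and only if φ satisfies the sine-Gordon equation ∂_t²φ − ∂_x²φ + (m²/β)·sin(βφ) = 0 on all of ℝ². -/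

import Mathlib

noncomputable section

open Matrix

def σ1 : Matrix (Fin 2) (Fin 2) ℂ := !![0, 1; 1, 0]
def σ2 : Matrix (Fin 2) (Fin 2) ℂ := !![0, -Complex.I; Complex.I, 0]
def σ3 : Matrix (Fin 2) (Fin 2) ℂ := !![1, 0; 0, -1]

def k0 (m : ℝ) (lam : ℂ) : ℂ := (m / 4) * (lam + lam⁻¹)
def k1 (m : ℝ) (lam : ℂ) : ℂ := (m / 4) * (lam - lam⁻¹)

/-- sine-Gordon space Lax matrix U(φ, φ_t; λ). -/
def USG (m β φ φt : ℝ) (lam : ℂ) : Matrix (Fin 2) (Fin 2) ℂ :=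
  (-Complex.I * k0 m lam * Real.sin (β * φ / 2)) • σ1
    + (-Complex.I * k1 m lam * Real.cos (β * φ / 2)) • σ2
    + (-Complex.I * (β / 4) * φt) • σ3

/-- sine-Gordon time Lax matrix V(φ, φ_x; λ). -/
def VSG (m β φ φx : ℝ) (lam : ℂ) : Matrix (Fin 2) (Fin 2) ℂ :=
  (-Complex.I * k1 m lam * Real.sin (β * φ / 2)) • σ1
    + (-Complex.I * k0 m lam * Real.cos (β * φ / 2)) • σ2
    + (-Complex.I * (β / 4) * φx) • σ3

/-- Entrywise directional derivative of a matrix-valued function on ℝ², coordinates (x,t). -/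
def mderiv (F : ℝ × ℝ → Matrix (Fin 2) (Fin 2) ℂ) (p v : ℝ × ℝ) :
    Matrix (Fin 2) (Fin 2) ℂ :=
  Matrix.of fun i j => fderiv ℝ (fun w => F w i j) p v

theorem entry_deriv (β : ℝ) (φ g : ℝ × ℝ → ℝ) (p v : ℝ × ℝ)
    (hφ : DifferentiableAt ℝ φ p) (hg : DifferentiableAt ℝ g p) (a b c x y z : ℂ) :
    fderiv ℝ (fun w => a * (Real.sin (β * φ w / 2) : ℝ) * x
      + b * (Real.cos (β * φ w / 2) : ℝ) * y + c * (g w : ℝ) * z) p v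
    = a * ((Real.cos (β * φ p / 2) * (β / 2 * fderiv ℝ φ p v) : ℝ) : ℂ) * x
      + b * ((-Real.sin (β * φ p / 2) * (β / 2 * fderiv ℝ φ p v) : ℝ) : ℂ) * y
      + c * ((fderiv ℝ g p v : ℝ) : ℂ) * z := by
  have h0 : HasFDerivAt (fun w => β * φ w / 2) ((β / 2) • fderiv ℝ φ p) p := by
    have := hφ.hasFDerivAt.const_mul (β / 2)
    refine this.congr_of_eventuallyEq (Filter.Eventually.of_forall fun w => ?_)
    ring
  have cast : ∀ {f : ℝ × ℝ → ℝ} {f' : ℝ × ℝ →L[ℝ] ℝ}, HasFDerivAt f f' p →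
      HasFDerivAt (fun w => (f w : ℂ)) (Complex.ofRealCLM.comp f') p := fun h =>
    Complex.ofRealCLM.hasFDerivAt.comp p h
  have h1 := ((cast h0.sin).const_mul a).mul_const x
  have h2 := ((cast h0.cos).const_mul b).mul_const y
  have h3 := ((cast hg.hasFDerivAt).const_mul c).mul_const z
  refine (congrArg (fun L : ℝ × ℝ →L[ℝ] ℂ => L v) ((h1.add h2).add h3).fderiv).trans ?_
  simp
  ring

theorem mderiv_lax (β : ℝ) (φ g : ℝ × ℝ → ℝ) (p v : ℝ × ℝ)
    (hφ : DifferentiableAt ℝ φ p) (hg : DifferentiableAt ℝ g p) (a b c : ℂ) :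
    mderiv (fun w => (a * (Real.sin (β * φ w / 2) : ℝ)) • σ1
      + (b * (Real.cos (β * φ w / 2) : ℝ)) • σ2 + (c * (g w : ℝ)) • σ3) p v
    = (a * ((Real.cos (β * φ p / 2) * (β / 2 * fderiv ℝ φ p v) : ℝ) : ℂ)) • σ1
      + (b * ((-Real.sin (β * φ p / 2) * (β / 2 * fderiv ℝ φ p v) : ℝ) : ℂ)) • σ2
      + (c * ((fderiv ℝ g p v : ℝ) : ℂ)) • σ3 := by
  ext i j
  exact entry_deriv β φ g p v hφ hg a b c (σ1 i j) (σ2 i j) (σ3 i j)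

/-- Covariant Hamilton equation for sine-Gordon: ∂_x V − ∂_t U = {H, W(λ)} holds for
all (x,t) and all nonzero λ iff φ solves the sine-Gordon equation. -/
theorem covariant_Hamilton_SG
    (m β : ℝ) (hβ : β ≠ 0) (φ : ℝ × ℝ → ℝ) (hφ : ContDiff ℝ 2 φ) :
    (∀ p : ℝ × ℝ, ∀ lam : ℂ, lam ≠ 0 →
      mderiv (fun w => VSG m β (φ w) (fderiv ℝ φ w (1, 0)) lam) p (1, 0)
        - mderiv (fun w => USG m β (φ w) (fderiv ℝ φ w (0, 1)) lam) p (0, 1)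
        = (Complex.I * (β / 2)
              * (k0 m lam * fderiv ℝ φ p (0, 1) - k1 m lam * fderiv ℝ φ p (1, 0))
              * Real.cos (β * φ p / 2)) • σ1
          + (Complex.I * (β / 2)
              * (k0 m lam * fderiv ℝ φ p (1, 0) - k1 m lam * fderiv ℝ φ p (0, 1))
              * Real.sin (β * φ p / 2)) • σ2
          + (-Complex.I * ((m : ℂ) ^ 2 / 4) * Real.sin (β * φ p)) • σ3)
    ↔ (∀ p : ℝ × ℝ,
        fderiv ℝ (fun w => fderiv ℝ φ w (0, 1)) p (0, 1)
          - fderiv ℝ (fun w => fderiv ℝ φ w (1, 0)) p (1, 0)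
          + (m ^ 2 / β) * Real.sin (β * φ p) = 0) := by
  have hd : Differentiable ℝ φ := hφ.differentiable (by norm_num)
  have hg : ∀ v : ℝ × ℝ, Differentiable ℝ (fun w => fderiv ℝ φ w v) := fun v =>
    ((hφ.fderiv_right (m := 1) (by norm_num)).clm_apply contDiff_const).differentiable
      (by norm_num)
  refine forall_congr' fun p => ?_
  simp only [USG, VSG]
  have hV := fun lam => mderiv_lax β φ (fun w => fderiv ℝ φ w (1, 0)) p (1, 0) (hd p) (hg _ p)
    (-Complex.I * k1 m lam) (-Complex.I * k0 m lam) (-Complex.I * (β / 4))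
  have hU := fun lam => mderiv_lax β φ (fun w => fderiv ℝ φ w (0, 1)) p (0, 1) (hd p) (hg _ p)
    (-Complex.I * k0 m lam) (-Complex.I * k1 m lam) (-Complex.I * (β / 4))
  simp only [hV, hU]
  generalize fderiv ℝ (fun w => fderiv ℝ φ w (0, 1)) p (0, 1) = tt
  generalize fderiv ℝ (fun w => fderiv ℝ φ w (1, 0)) p (1, 0) = xx
  generalize Real.sin (β * φ p) = S
  have hb : (β : ℂ) ≠ 0 := by exact_mod_cast hβ
  constructor
  · intro h
    have h := congrFun (congrFun (h 1 one_ne_zero) 0) 0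
    simp [σ1, σ2, σ3] at h
    have h2 : ((β * (xx - tt) : ℝ) : ℂ) = ((m ^ 2 * S : ℝ) : ℂ) := by
      push_cast
      linear_combination 4 * Complex.I * h
        + ((β : ℂ) * (xx - tt) - (m : ℂ) ^ 2 * S) * Complex.I_sq
    have h3 : β * (xx - tt) = m ^ 2 * S := by exact_mod_cast h2
    field_simp
    linear_combination -h3
  · intro h lam _
    have h3 : β * (xx - tt) = m ^ 2 * S := by
      field_simp at h
      linear_combination -h
    have h2 : (β : ℂ) * (xx - tt) = (m : ℂ) ^ 2 * S := by exact_mod_cast h3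
    ext i j
    simp only [Matrix.sub_apply, Matrix.add_apply, Matrix.smul_apply, smul_eq_mul]
    push_cast
    linear_combination (-Complex.I / 4 * σ3 i j) * h2
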